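/- arXiv:1307.3472 — 2 statements merged into one kernel-verified Lean document; each statement's English description precedes it below -/
import Mathlib

section
/- Let i be a positive integer, let m = i(i+1)/2, let h be a positive integer divisible by m, and set d = h/m. Let L > 0 be a real number and consider the set of i·d rectangular tiles consisting of d copies each of the rectangles k × L for k = 1, 2, …, i. Then for every divisor f of h with f ≥ i, this tile set tiles a rectangle of dimensions f × (hL/f). -/
/-- The axis-aligned `w × h` rectangle `[0,w] × [0,h]` in the plane. -/
def rectWH (w h : ℝ) : Set (ℝ × ℝ) := Set.Icc 0 w ×ˢ Set.Icc 0 h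

/-- `S` is a placement of a `w × h` rectangle: a translate of `[0,w] × [0,h]`, optionally
preceded by a 90° rotation (which interchanges the roles of `w` and `h`). -/
def IsPlacement (w h : ℝ) (S : Set (ℝ × ℝ)) : Prop :=
  ∃ v : ℝ × ℝ, S = (fun p => p + v) '' rectWH w h ∨ S = (fun p => p + v) '' rectWH h w

/-- The tile set `dims` (of `n` rectangles) tiles a `W × H` rectangle: there exist placements
of the tiles with pairwise disjoint interiors whose union is `[0,W] × [0,H]`. -/
def TilesRect {n : ℕ} (dims : Fin n → ℝ × ℝ) (W H : ℝ) : Prop :=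
  ∃ P : Fin n → Set (ℝ × ℝ),
    (∀ i, IsPlacement (dims i).1 (dims i).2 (P i)) ∧
    (∀ i j, i ≠ j → interior (P i) ∩ interior (P j) = ∅) ∧
    (⋃ i, P i) = rectWH W H

/-- The `i·d` tiles: `d` copies each of the rectangles `k × L` for `k = 1, …, i`
(tile number `j` has width `j / d + 1`). -/
noncomputable def dimsGen (i d : ℕ) (L : ℝ) : Fin (i * d) → ℝ × ℝ :=
  fun j => ((((j : ℕ) / d + 1 : ℕ) : ℝ), L)

/-- The multiset of the `k` consecutive natural numbers starting at `a`. -/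
def natRun (a k : ℕ) : Multiset ℕ := (Multiset.range k).map (a + ·)

/-- `M` splits into `g` groups, each of sum `f`. -/
def SplitsInto (M : Multiset ℕ) (f g : ℕ) : Prop :=
  ∃ P : Fin g → Multiset ℕ, ∑ i, P i = M ∧ ∀ i, (P i).sum = f

/-- `M` splits into groups of sum `f`. -/
def Splits (M : Multiset ℕ) (f : ℕ) : Prop := ∃ g, SplitsInto M f g

theorem natRun_add (a k l : ℕ) : natRun a (k + l) = natRun a k + natRun (a + k) l := by
  simp [natRun, Multiset.range_add, Multiset.map_add, Multiset.map_map, add_assoc]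

theorem natRun_zero (a : ℕ) : natRun a 0 = 0 := rfl

theorem natRun_one (a : ℕ) : natRun a 1 = {a} := by simp [natRun]

theorem card_natRun (a k : ℕ) : (natRun a k).card = k := by simp [natRun]

theorem mem_natRun {a k x : ℕ} : x ∈ natRun a k ↔ a ≤ x ∧ x < a + k := by
  simp only [natRun, Multiset.mem_map, Multiset.mem_range]
  constructor
  · rintro ⟨y, hy, rfl⟩; omega
  · rintro ⟨h1, h2⟩; exact ⟨x - a, by omega, by omega⟩

theorem nodup_natRun (a k : ℕ) : (natRun a k).Nodup :=
  (Multiset.nodup_range k).map (fun x y h => by simpa using h)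

theorem map_sub_range (b k : ℕ) (h : k ≤ b + 1) :
    (Multiset.range k).map (fun j => b - j) = natRun (b + 1 - k) k := by
  induction k with
  | zero => rfl
  | succ k ih =>
    rw [Multiset.range_succ, Multiset.map_cons, ih (by omega), add_comm k 1, natRun_add, natRun_one,
      Multiset.singleton_add, show b + 1 - (1 + k) + 1 = b + 1 - k by omega,
      show b + 1 - (1 + k) = b - k by omega]

theorem map_sub_two_mul_range (b p : ℕ) (h : 2 * p ≤ b + 1) :
    (Multiset.range p).map (fun j => b - 2 * j) + (Multiset.range p).map (fun j => b - 1 - 2 * j)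
      = natRun (b + 1 - 2 * p) (2 * p) := by
  induction p with
  | zero => rfl
  | succ p ih =>
    rw [show 2 * (p + 1) = 1 + (1 + 2 * p) by ring, natRun_add, natRun_add, natRun_one, natRun_one,
      show b + 1 - (1 + (1 + 2 * p)) + 1 + 1 = b + 1 - 2 * p by omega, ← ih (by omega),
      Multiset.range_succ, Multiset.map_cons, Multiset.map_cons,
      show b + 1 - (1 + (1 + 2 * p)) = b - 1 - 2 * p by omega,
      show b - 1 - 2 * p + 1 = b - 2 * p by omega, ← Multiset.singleton_add,
      ← Multiset.singleton_add (b - 1 - 2 * p)]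
    abel

theorem map_mirror_natRun (c r : ℕ) (h : 2 * r ≤ c + 1) :
    (natRun r (c + 1 - 2 * r)).map (c - ·) = natRun r (c + 1 - 2 * r) := by
  have := map_sub_range (c - r) (c + 1 - 2 * r) (by omega)
  rw [show c - r + 1 - (c + 1 - 2 * r) = r by omega] at this
  rw [← this, Multiset.map_map, this, natRun]
  exact Multiset.map_congr rfl fun x hx => by
    have := Multiset.mem_range.1 hx
    simp only [Function.comp_apply]; omega

theorem bind_pair {α : Type*} (s : Multiset α) (a b : α → ℕ) :
    s.bind (fun j => {a j, b j}) = s.map a + s.map b := by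
  induction s using Multiset.induction_on with
  | empty => rfl
  | cons x s ih =>
    rw [Multiset.cons_bind, ih]
    simp only [Multiset.map_cons, Multiset.insert_eq_cons, ← Multiset.singleton_add (_ : ℕ)]
    abel

theorem bind_triple {α : Type*} (s : Multiset α) (a b c : α → ℕ) :
    s.bind (fun j => {a j, b j, c j}) = s.map a + s.map b + s.map c := by
  induction s using Multiset.induction_on with
  | empty => rfl
  | cons x s ih =>
    rw [Multiset.cons_bind, ih]
    simp only [Multiset.map_cons, Multiset.insert_eq_cons, ← Multiset.singleton_add (_ : ℕ)]
    abel

theorem SplitsInto.zero (f : ℕ) : SplitsInto 0 f 0 := ⟨fun _ => 0, by simp, fun i => i.elim0⟩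

theorem SplitsInto.add {M N : Multiset ℕ} {f g k : ℕ} (hM : SplitsInto M f g)
    (hN : SplitsInto N f k) : SplitsInto (M + N) f (g + k) := by
  obtain ⟨P, hP, hPs⟩ := hM
  obtain ⟨Q, hQ, hQs⟩ := hN
  refine ⟨Fin.append P Q, by simp [Fin.sum_univ_add, hP, hQ], fun i => ?_⟩
  induction i using Fin.addCases with
  | left i => simpa using hPs i
  | right i => simpa using hQs i

theorem SplitsInto.concat {M N : Multiset ℕ} {f f' g : ℕ} (hM : SplitsInto M f g)
    (hN : SplitsInto N f' g) : SplitsInto (M + N) (f + f') g := by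
  obtain ⟨P, hP, hPs⟩ := hM
  obtain ⟨Q, hQ, hQs⟩ := hN
  exact ⟨fun i => P i + Q i, by rw [Finset.sum_add_distrib, hP, hQ], fun i => by simp [hPs, hQs]⟩

theorem SplitsInto.merge {M : Multiset ℕ} {f g : ℕ} (hM : SplitsInto M f (g + g)) :
    SplitsInto M (f + f) g := by
  obtain ⟨P, hP, hPs⟩ := hM
  refine ⟨fun i => P (Fin.castAdd g i) + P (Fin.natAdd g i), ?_, fun i => by simp [hPs]⟩
  rw [Finset.sum_add_distrib, ← hP, Fin.sum_univ_add]

theorem SplitsInto.sum_eq {M : Multiset ℕ} {f g : ℕ} (hM : SplitsInto M f g) :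
    M.sum = g * f := by
  obtain ⟨P, rfl, hPs⟩ := hM
  rw [← Multiset.coe_sumAddMonoidHom, map_sum]
  simp [hPs]

theorem SplitsInto.singleton {s : Multiset ℕ} {f : ℕ} (h : s.sum = f) : SplitsInto s f 1 :=
  ⟨fun _ => s, by simp, fun _ => h⟩

theorem SplitsInto.bind {α : Type*} {f : ℕ} (t : α → Multiset ℕ) (s : Multiset α)
    (h : ∀ x ∈ s, (t x).sum = f) : SplitsInto (s.bind t) f s.card := by
  induction s using Multiset.induction_on with
  | empty => exact SplitsInto.zero f
  | cons x s ih =>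
    rw [Multiset.cons_bind, Multiset.card_cons, add_comm s.card]
    exact (SplitsInto.singleton (h x (by simp))).add (ih fun y hy => h y (by simp [hy]))

theorem SplitsInto.splits {M : Multiset ℕ} {f g : ℕ} (h : SplitsInto M f g) : Splits M f := ⟨g, h⟩

theorem Splits.zero (f : ℕ) : Splits 0 f := ⟨0, .zero f⟩

theorem Splits.add {M N : Multiset ℕ} {f : ℕ} (hM : Splits M f) (hN : Splits N f) :
    Splits (M + N) f :=
  let ⟨_, h⟩ := hM
  let ⟨_, h'⟩ := hN
  ⟨_, h.add h'⟩

theorem Splits.nsmul {M : Multiset ℕ} {f : ℕ} (hM : Splits M f) (k : ℕ) : Splits (k • M) f := by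
  induction k with
  | zero => simpa using Splits.zero f
  | succ k ih => rw [succ_nsmul]; exact ih.add hM

theorem Splits.splitsInto {M : Multiset ℕ} {f g : ℕ} (hM : Splits M f) (hf : 0 < f)
    (h : M.sum = g * f) : SplitsInto M f g := by
  obtain ⟨k, hk⟩ := hM
  have := hk.sum_eq
  rw [h] at this
  rwa [Nat.eq_of_mul_eq_mul_right hf this]

theorem Splits.dvd_sum {M : Multiset ℕ} {f : ℕ} (hM : Splits M f) : f ∣ M.sum := by
  obtain ⟨k, hk⟩ := hM
  exact ⟨k, by rw [hk.sum_eq, mul_comm]⟩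

theorem Splits.merge {M : Multiset ℕ} {f : ℕ} (hM : Splits M f) (hf : 0 < f)
    (h : 2 * f ∣ M.sum) : Splits M (2 * f) := by
  obtain ⟨k, hk⟩ := h
  rw [two_mul f]
  exact ⟨k, (hM.splitsInto (g := k + k) hf (by rw [hk]; ring)).merge⟩

/-- A mirror-symmetric multiset with an even number of centres is a union of mirror pairs. -/
theorem exists_mirror_half (c : ℕ) (D : Multiset ℕ) (hD : ∀ x ∈ D, x ≤ c)
    (hsymm : D.map (c - ·) = D) (hc : ∀ x, 2 * x = c → Even (D.count x)) :
    ∃ Y : Multiset ℕ, Y + Y.map (c - ·) = D ∧ ∀ y ∈ Y, y ≤ c := by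
  have hgt : D.filter (fun x => c < 2 * x) = (D.filter (fun x => 2 * x < c)).map (c - ·) := by
    conv_lhs => rw [← hsymm]
    rw [Multiset.filter_map]
    congr 1
    refine Multiset.filter_congr fun x hx => ?_
    have := hD x hx
    simp only [Function.comp_apply]; omega
  obtain ⟨E, hE, hEc⟩ : ∃ E : Multiset ℕ, E + E.map (c - ·) = D.filter (fun x => 2 * x = c) ∧
      ∀ y ∈ E, y ≤ c := by
    by_cases h : 2 * (c / 2) = c
    · obtain ⟨m, hm⟩ := hc _ h
      refine ⟨Multiset.replicate m (c / 2), ?_, fun y hy => ?_⟩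
      · rw [Multiset.map_replicate, show c - c / 2 = c / 2 by omega, ← Multiset.replicate_add, ← hm,
          ← Multiset.filter_eq']
        exact Multiset.filter_congr fun x _ => by omega
      · rw [Multiset.eq_of_mem_replicate hy]; omega
    · refine ⟨0, ?_, by simp⟩
      symm
      simp only [Multiset.map_zero, add_zero, Multiset.filter_eq_nil]
      intro x _; omega
  refine ⟨D.filter (fun x => 2 * x < c) + E, ?_, fun y hy => ?_⟩
  · have h1 := Multiset.filter_add_not (fun x => 2 * x < c) D
    have h2 := Multiset.filter_add_not (fun x => 2 * x = c) (D.filter (fun x => ¬ 2 * x < c))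
    rw [Multiset.filter_filter, Multiset.filter_filter] at h2
    have h3 : D.filter (fun x => 2 * x = c ∧ ¬ 2 * x < c) = D.filter (fun x => 2 * x = c) :=
      Multiset.filter_congr fun x _ => by omega
    have h4 : D.filter (fun x => ¬ 2 * x = c ∧ ¬ 2 * x < c) = D.filter (fun x => c < 2 * x) :=
      Multiset.filter_congr fun x _ => by omega
    rw [h3, h4, ← hE, hgt] at h2
    conv_rhs => rw [← h1, ← h2]
    rw [Multiset.map_add]
    abel
  · rcases Multiset.mem_add.1 hy with hy | hy
    · have := (Multiset.mem_filter.1 hy).2; omega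
    · exact hEc y hy

/-- Exchange step: every element of `U` is raised by `e` while four further copies of the
mirror-symmetric run are split into quadruples of sum `2 * c - e`. -/
theorem exists_raise (c r e : ℕ) (U : Multiset ℕ) (hr : 2 * r ≤ c)
    (hU : ∀ x ∈ U, r ≤ x ∧ x + e + r ≤ c) (hcount : ∀ x, U.count x ≤ 2)
    (hcard : U.card = c + 1 - 2 * r) :
    ∃ Q, Splits Q (2 * c - e) ∧
      U.map (· + e) + Q = U + 4 • natRun r (c + 1 - 2 * r) := by
  set F := natRun r (c + 1 - 2 * r) with hF
  set Z := U.map (· + e) with hZ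
  have hZm : ∀ x ∈ Z, r ≤ x ∧ x + r ≤ c := by
    intro x hx
    obtain ⟨y, hy, rfl⟩ := Multiset.mem_map.1 hx
    have := hU y hy
    omega
  have hZc : ∀ x, Z.count x ≤ 2 := by
    intro x
    by_cases hx : x ∈ Z
    · obtain ⟨y, hy, rfl⟩ := Multiset.mem_map.1 hx
      rw [hZ, Multiset.count_map_eq_count' (· + e) U (fun a b h => by simpa using h)]
      exact hcount y
    · simp [Multiset.count_eq_zero_of_notMem hx]
  have hmir : ∀ x, x ≤ c → (Z.map (c - ·)).count x = Z.count (c - x) := by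
    intro x hx
    by_cases hx' : c - x ∈ Z
    · conv_lhs => rw [show x = c - (c - x) by omega]
      refine Multiset.count_map_eq_count (c - ·) Z (fun a ha b hb h => ?_) _ hx'
      have := hZm a ha
      have := hZm b hb
      simp only at h
      omega
    · rw [Multiset.count_eq_zero_of_notMem hx', Multiset.count_eq_zero]
      intro h
      obtain ⟨y, hy, hyx⟩ := Multiset.mem_map.1 h
      have := hZm y hy
      exact hx' (by rwa [show c - x = y by omega])
  have hFc : ∀ x ∈ F, F.count x = 1 := fun x hx =>
    Multiset.count_eq_one_of_mem (nodup_natRun _ _) hx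
  have hmemF : ∀ x, r ≤ x → x + r ≤ c → x ∈ F := fun x h1 h2 => mem_natRun.2 (by omega)
  have hle : Z + Z.map (c - ·) ≤ 4 • F := by
    rw [Multiset.le_iff_count]
    intro x
    rw [Multiset.count_add, Multiset.count_nsmul]
    by_cases hx : x ∈ F
    · have h1 := mem_natRun.1 hx
      rw [hFc x hx, hmir x (by omega)]
      have := hZc x
      have := hZc (c - x)
      omega
    · have h1 : x ∉ Z := fun h => hx (hmemF x (hZm x h).1 (hZm x h).2)
      have h2 : x ∉ Z.map (c - ·) := fun h => by
        obtain ⟨y, hy, rfl⟩ := Multiset.mem_map.1 h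
        have := hZm y hy
        exact hx (hmemF _ (by omega) (by omega))
      simp [Multiset.count_eq_zero_of_notMem h1, Multiset.count_eq_zero_of_notMem h2]
  obtain ⟨D, hD⟩ := Multiset.le_iff_exists_add.1 hle
  have hZmm : (Z.map (c - ·)).map (c - ·) = Z := by
    rw [Multiset.map_map]
    conv_rhs => rw [← Multiset.map_id' Z]
    refine Multiset.map_congr rfl fun x hx => ?_
    have := hZm x hx
    simp only [Function.comp_apply]; omega
  have hDF : ∀ x ∈ D, x ∈ F := fun x hx => by
    have : x ∈ 4 • F := by rw [hD]; exact Multiset.mem_add.2 (Or.inr hx)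
    exact Multiset.mem_of_mem_nsmul this
  obtain ⟨Y, hY, hYc⟩ := exists_mirror_half c D
    (fun x hx => by have := mem_natRun.1 (hDF x hx); omega)
    (by
      have := congrArg (Multiset.map (c - ·)) hD
      rw [Multiset.map_nsmul, map_mirror_natRun c r (by omega), ← hF, hD, Multiset.map_add,
        Multiset.map_add, hZmm, add_comm (Z.map _) Z] at this
      exact (add_left_cancel this).symm)
    (fun x hx => by
      by_cases hxF : x ∈ F
      · have := congrArg (Multiset.count x) hD
        rw [Multiset.count_nsmul, hFc x hxF, Multiset.count_add, Multiset.count_add,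
          hmir x (by omega), show c - x = x by omega] at this
        exact ⟨2 - Z.count x, by omega⟩
      · simp [Multiset.count_eq_zero_of_notMem fun h => hxF (hDF x h)])
  have hYcard : Y.card = U.card := by
    have h1 := congrArg Multiset.card hD
    have h2 := congrArg Multiset.card hY
    simp only [Multiset.card_add, Multiset.card_nsmul, Multiset.card_map, hF, hZ, card_natRun]
      at h1 h2
    omega
  refine ⟨U.bind (fun u => {u, c - (u + e)}) + Y.bind (fun y => {y, c - y}), ?_, ?_⟩
  · have h1 : SplitsInto (U.bind (fun u => {u, c - (u + e)})) (c - e) U.card :=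
      SplitsInto.bind _ _ fun u hu => by
        have := hU u hu
        simp only [Multiset.insert_eq_cons, Multiset.sum_cons, Multiset.sum_singleton]
        omega
    have h2 : SplitsInto (Y.bind (fun y => {y, c - y})) c Y.card :=
      SplitsInto.bind _ _ fun y hy => by
        have := hYc y hy
        simp only [Multiset.insert_eq_cons, Multiset.sum_cons, Multiset.sum_singleton]
        omega
    rw [hYcard] at h2
    have h3 := (h1.concat h2).splits
    rcases Multiset.empty_or_exists_mem U with h0 | ⟨u, hu⟩
    · subst h0; simp at hcard; omega
    · have := hU u hu
      rwa [show c - e + c = 2 * c - e by omega] at h3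
  · have hW : Z.map (c - ·) = U.map (fun u => c - (u + e)) := by
      rw [hZ, Multiset.map_map]; rfl
    rw [bind_pair, bind_pair, hD, ← hY, hW, Multiset.map_id', Multiset.map_id']
    abel

/-- Iterated exchange step: every element of `U` is raised by `K * e` at the cost of `4 * K` copies of
the mirror-symmetric run. -/
theorem exists_raise_mul (c r e : ℕ) (hr : 2 * r ≤ c) (K : ℕ) (U : Multiset ℕ)
    (hU : ∀ x ∈ U, r ≤ x ∧ x + K * e + r ≤ c) (hcount : ∀ x, U.count x ≤ 2)
    (hcard : U.card = c + 1 - 2 * r) :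
    ∃ Q, Splits Q (2 * c - e) ∧
      U.map (· + K * e) + Q = U + (4 * K) • natRun r (c + 1 - 2 * r) := by
  induction K with
  | zero => exact ⟨0, Splits.zero _, by simp⟩
  | succ K ih =>
    obtain ⟨Q, hQ, hQU⟩ := ih fun x hx => by
      have := hU x hx
      rw [add_mul] at this
      omega
    obtain ⟨Q', hQ', hQU'⟩ := exists_raise c r e (U.map (· + K * e)) hr
      (fun x hx => by
        obtain ⟨y, hy, rfl⟩ := Multiset.mem_map.1 hx
        have := hU y hy
        rw [add_mul] at this
        omega)
      (fun x => by
        by_cases hx : x ∈ U.map (· + K * e)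
        · obtain ⟨y, hy, rfl⟩ := Multiset.mem_map.1 hx
          rw [Multiset.count_map_eq_count' (· + K * e) U (fun a b h => by simpa using h)]
          exact hcount y
        · simp [Multiset.count_eq_zero_of_notMem hx])
      (by simpa using hcard)
    refine ⟨Q' + Q, hQ'.add hQ, ?_⟩
    rw [Multiset.map_map] at hQU'
    have : U.map (· + (K + 1) * e) = U.map ((· + e) ∘ (· + K * e)) :=
      Multiset.map_congr rfl fun x _ => by simp only [Function.comp_apply]; ring
    rw [this, ← add_assoc, hQU', add_right_comm, hQU, mul_add, add_nsmul]
    abel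

theorem count_natRun (a k x : ℕ) :
    (natRun a k).count x = if a ≤ x ∧ x < a + k then 1 else 0 := by
  split_ifs with h
  · exact Multiset.count_eq_one_of_mem (nodup_natRun _ _) (mem_natRun.2 h)
  · exact Multiset.count_eq_zero_of_notMem fun hx => h (mem_natRun.1 hx)

theorem natRun_append {a k b l : ℕ} (h : a + k = b) :
    natRun a k + natRun b l = natRun a (k + l) := by
  rw [natRun_add, h]

theorem map_sub_two_mul_range_succ (b w : ℕ) (h : 2 * w ≤ b) :
    (Multiset.range (w + 1)).map (fun j => b - 2 * j) +
      (Multiset.range w).map (fun j => b - 1 - 2 * j) = natRun (b - 2 * w) (2 * w + 1) := by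
  rw [add_comm (2 * w), natRun_add, natRun_one, show b - 2 * w + 1 = b + 1 - 2 * w by omega,
    ← map_sub_two_mul_range b w (by omega), Multiset.range_succ, Multiset.map_cons,
    ← Multiset.singleton_add]
  abel

/-- With `q = 2 * K + 2`, `2 * q - 1` copies of `[r, q * e - r]` split into groups of sum
`(2 * q - 1) * e`. -/
theorem splits_symm_run_even (K e r : ℕ) (hre : r ≤ e) :
    Splits ((4 * K + 3) • natRun r ((2 * K + 2) * e + 1 - 2 * r)) ((4 * K + 3) * e) := by
  obtain ⟨w, hw⟩ : ∃ w, r + w = (K + 1) * e := ⟨(K + 1) * e - r, by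
    have : r ≤ (K + 1) * e := by nlinarith
    omega⟩
  have hc : (2 * K + 2) * e = 2 * r + 2 * w := by linarith
  have hwK : K * e ≤ w := by linarith
  have hwK' : w + r = K * e + e := by linarith
  have hlen : 2 * r + 2 * w + 1 - 2 * r = 2 * w + 1 := by omega
  rw [hc, hlen]
  obtain ⟨Q, hQ, hQU⟩ := exists_raise_mul (2 * r + 2 * w) r e (by omega) K
    (natRun r (w + 1) + natRun r w)
    (fun x hx => by
      rw [Multiset.mem_add, mem_natRun, mem_natRun] at hx
      omega)
    (fun x => by
      rw [Multiset.count_add, count_natRun, count_natRun]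
      split_ifs <;> omega)
    (by rw [Multiset.card_add, card_natRun, card_natRun]; omega)
  rw [hlen] at hQU
  have hfe : (4 * K + 3) * e = 3 * (r + w) + K * e := by linarith
  have h1 : Splits ((Multiset.range (w + 1)).bind
      fun j => {r + j + K * e, r + w + j, r + 2 * w - 2 * j}) ((4 * K + 3) * e) :=
    (SplitsInto.bind _ _ fun j hj => by
      rw [Multiset.mem_range] at hj
      simp only [Multiset.insert_eq_cons, Multiset.sum_cons, Multiset.sum_singleton]
      omega).splits
  have h2 : Splits ((Multiset.range w).bind
      fun j => {r + j + K * e, r + w + 1 + j, r + 2 * w - 1 - 2 * j}) ((4 * K + 3) * e) :=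
    (SplitsInto.bind _ _ fun j hj => by
      rw [Multiset.mem_range] at hj
      simp only [Multiset.insert_eq_cons, Multiset.sum_cons, Multiset.sum_singleton]
      omega).splits
  have hQ' : 2 * (2 * r + 2 * w) - e = (4 * K + 3) * e := by omega
  rw [hQ'] at hQ
  have h := (h1.add h2).add hQ
  rw [bind_triple, bind_triple] at h
  have e1 := map_sub_two_mul_range_succ (r + 2 * w) w (by omega)
  rw [show r + 2 * w - 2 * w = r by omega] at e1
  have e2 : natRun r w + natRun (r + w) (w + 1) = natRun r (2 * w + 1) := by
    rw [natRun_append rfl]; congr 1; omega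
  have e3 : natRun r (w + 1) + natRun (r + w + 1) w = natRun r (2 * w + 1) := by
    rw [natRun_append (by omega)]; congr 1; omega
  simp only [natRun, Multiset.map_add, Multiset.map_map, Function.comp_def] at h hQU e1 e2 e3 ⊢
  convert h using 1
  ext x
  replace hQU := congrArg (Multiset.count x) hQU
  replace e1 := congrArg (Multiset.count x) e1
  replace e2 := congrArg (Multiset.count x) e2
  replace e3 := congrArg (Multiset.count x) e3
  simp only [Multiset.count_add, Multiset.count_nsmul] at hQU e1 e2 e3 ⊢
  linarith

/-- With `q = 2 * K + 3` and `e = 2 * ε + 1`, `2 * q - 1` copies of `[r, q * e - r]` split into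
groups of sum `(2 * q - 1) * e`. -/
theorem splits_symm_run_odd (K ε r s : ℕ) (hr : r ≤ 2 * ε + 1)
    (hs : 2 * r + 2 * ε + 2 * s + 1 = (2 * K + 3) * (2 * ε + 1)) :
    Splits ((4 * K + 5) • natRun r (2 * (ε + 1 + s))) ((4 * K + 5) * (2 * ε + 1)) := by
  set e := 2 * ε + 1 with he
  have hlen : 2 * r + 2 * ε + 2 * s + 1 + 1 - 2 * r = 2 * (ε + 1 + s) := by omega
  have hKe : K * e + e + ε + 1 = r + ε + 1 + s := by linarith
  obtain ⟨Q, hQ, hQU⟩ := exists_raise_mul (2 * r + 2 * ε + 2 * s + 1) r e (by omega) K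
    ((natRun r (s + 1) + natRun (r + ε + 1 + s) ε) + (natRun r s + natRun (r + ε + 1 + s) (ε + 1)))
    (fun x hx => by
      simp only [Multiset.mem_add, mem_natRun] at hx
      omega)
    (fun x => by
      simp only [Multiset.count_add, count_natRun]
      split_ifs <;> omega)
    (by simp only [Multiset.card_add, card_natRun]; omega)
  rw [hlen] at hQU
  have hQ' : 2 * (2 * r + 2 * ε + 2 * s + 1) - e = (4 * K + 5) * e := by
    have : (4 * K + 5) * e = 4 * (K * e) + 5 * e := by ring
    omega
  rw [hQ'] at hQ
  have hfe : (4 * K + 5) * e = (r + ε + 1 + s) + (2 * r + 2 * ε + 2 * s + 1) + ε + K * e := by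
    have : (4 * K + 5) * e = 4 * (K * e) + 5 * e := by ring
    omega
  have hA1 : Splits ((Multiset.range (s + 1)).bind
      fun j => {r + j + K * e, r + ε + 1 + s + ε + j, r + 2 * ε + 2 * s + 1 - 2 * j})
      ((4 * K + 5) * e) :=
    (SplitsInto.bind _ _ fun j hj => by
      rw [Multiset.mem_range] at hj
      simp only [Multiset.insert_eq_cons, Multiset.sum_cons, Multiset.sum_singleton]
      omega).splits
  have hA2 : Splits ((Multiset.range ε).bind
      fun j => {r + ε + 1 + s + j + K * e, r + ε + 1 + s + (s + 1) + j,
        r + 2 * ε + 2 * s + 1 - 2 * (s + 1 + j)})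
      ((4 * K + 5) * e) :=
    (SplitsInto.bind _ _ fun j hj => by
      rw [Multiset.mem_range] at hj
      simp only [Multiset.insert_eq_cons, Multiset.sum_cons, Multiset.sum_singleton]
      omega).splits
  have hB1 : Splits ((Multiset.range s).bind
      fun j => {r + j + K * e, r + ε + 1 + s + (ε + 1) + j, r + 2 * ε + 2 * s + 1 - 1 - 2 * j})
      ((4 * K + 5) * e) :=
    (SplitsInto.bind _ _ fun j hj => by
      rw [Multiset.mem_range] at hj
      simp only [Multiset.insert_eq_cons, Multiset.sum_cons, Multiset.sum_singleton]
      omega).splits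
  have hB2 : Splits ((Multiset.range (ε + 1)).bind
      fun j => {r + ε + 1 + s + j + K * e, r + ε + 1 + s + s + j,
        r + 2 * ε + 2 * s + 1 - 1 - 2 * (s + j)})
      ((4 * K + 5) * e) :=
    (SplitsInto.bind _ _ fun j hj => by
      rw [Multiset.mem_range] at hj
      simp only [Multiset.insert_eq_cons, Multiset.sum_cons, Multiset.sum_singleton]
      omega).splits
  have hC1 : SplitsInto ((Multiset.range (ε + 1 + s)).bind
      fun k => {r + ε + s - k, r + s + 1 + k}) (2 * r + ε + 2 * s + 1) (ε + 1 + s) := by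
    simpa using SplitsInto.bind (f := 2 * r + ε + 2 * s + 1)
      (fun k => {r + ε + s - k, r + s + 1 + k}) (Multiset.range (ε + 1 + s)) fun k hk => by
      rw [Multiset.mem_range] at hk
      simp only [Multiset.insert_eq_cons, Multiset.sum_cons, Multiset.sum_singleton]
      omega
  have hC2 : SplitsInto ((Multiset.range (ε + 1 + s)).bind
      fun k => {r + ε + s - k, r + s + k}) (2 * r + ε + 2 * s) (ε + 1 + s) := by
    simpa using SplitsInto.bind (f := 2 * r + ε + 2 * s)
      (fun k => {r + ε + s - k, r + s + k}) (Multiset.range (ε + 1 + s)) fun k hk => by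
      rw [Multiset.mem_range] at hk
      simp only [Multiset.insert_eq_cons, Multiset.sum_cons, Multiset.sum_singleton]
      omega
  have hC := (hC1.concat hC2).splits
  rw [show 2 * r + ε + 2 * s + 1 + (2 * r + ε + 2 * s) = (4 * K + 5) * e by omega] at hC
  have h := ((((hA1.add hA2).add hB1).add hB2).add hC).add hQ
  simp only [bind_triple, bind_pair] at h
  have t1 := map_sub_two_mul_range (r + 2 * ε + 2 * s + 1) (ε + 1 + s) (by omega)
  rw [show r + 2 * ε + 2 * s + 1 + 1 - 2 * (ε + 1 + s) = r by omega] at t1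
  have t2 : (Multiset.range (ε + 1 + s)).map (fun j => r + 2 * ε + 2 * s + 1 - 2 * j) =
      (Multiset.range (s + 1)).map (fun j => r + 2 * ε + 2 * s + 1 - 2 * j) +
      (Multiset.range ε).map (fun j => r + 2 * ε + 2 * s + 1 - 2 * (s + 1 + j)) := by
    rw [show ε + 1 + s = s + 1 + ε by ring, Multiset.range_add, Multiset.map_add, Multiset.map_map]
    rfl
  have t3 : (Multiset.range (ε + 1 + s)).map (fun j => r + 2 * ε + 2 * s + 1 - 1 - 2 * j) =
      (Multiset.range s).map (fun j => r + 2 * ε + 2 * s + 1 - 1 - 2 * j) +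
      (Multiset.range (ε + 1)).map (fun j => r + 2 * ε + 2 * s + 1 - 1 - 2 * (s + j)) := by
    rw [add_comm (ε + 1), Multiset.range_add, Multiset.map_add, Multiset.map_map]
    rfl
  rw [t2, t3] at t1
  have q1 := map_sub_range (r + ε + s) (ε + 1 + s) (by omega)
  rw [show r + ε + s + 1 - (ε + 1 + s) = r by omega] at q1
  have q2 : natRun r (ε + 1 + s) + (natRun (r + ε + 1 + s) ε + natRun (r + ε + 1 + s + ε) (s + 1))
      = natRun r (2 * (ε + 1 + s)) := by
    rw [natRun_append rfl, natRun_append (by omega)]; congr 1; omega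
  have q3 : natRun r (ε + 1 + s) +
      (natRun (r + ε + 1 + s) (ε + 1) + natRun (r + ε + 1 + s + (ε + 1)) s)
      = natRun r (2 * (ε + 1 + s)) := by
    rw [natRun_append rfl, natRun_append (by omega)]; congr 1; omega
  have q4 : natRun r (s + 1) +
      (natRun (r + s + 1) (ε + 1 + s) + natRun (r + ε + 1 + s + (s + 1)) ε)
      = natRun r (2 * (ε + 1 + s)) := by
    rw [natRun_append (by omega), natRun_append (by omega)]; congr 1; omega
  have q5 : natRun r s +
      (natRun (r + s) (ε + 1 + s) + natRun (r + ε + 1 + s + s) (ε + 1))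
      = natRun r (2 * (ε + 1 + s)) := by
    rw [natRun_append (by omega), natRun_append (by omega)]; congr 1; omega
  simp only [q1] at h
  simp only [natRun, Multiset.map_add, Multiset.map_map, Function.comp_def]
    at h hQU t1 q2 q3 q4 q5 ⊢
  convert h using 1
  ext x
  replace hQU := congrArg (Multiset.count x) hQU
  replace t1 := congrArg (Multiset.count x) t1
  replace q2 := congrArg (Multiset.count x) q2
  replace q3 := congrArg (Multiset.count x) q3
  replace q4 := congrArg (Multiset.count x) q4
  replace q5 := congrArg (Multiset.count x) q5
  simp only [Multiset.count_add, Multiset.count_nsmul] at hQU t1 q2 q3 q4 q5 ⊢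
  linarith

theorem splitsInto_natRun_pairs (a b m : ℕ) :
    SplitsInto (natRun a m + natRun b m) (a + b + m - 1) m := by
  rcases Nat.eq_zero_or_pos m with rfl | hm
  · exact SplitsInto.zero _
  have h := SplitsInto.bind (f := a + b + m - 1) (fun j => {a + j, b + m - 1 - j})
    (Multiset.range m) fun j hj => by
      rw [Multiset.mem_range] at hj
      simp only [Multiset.insert_eq_cons, Multiset.sum_cons, Multiset.sum_singleton]
      omega
  rwa [bind_pair, map_sub_range _ _ (by omega), Multiset.card_range,
    show b + m - 1 + 1 - m = b by omega] at h

theorem two_mul_sum_natRun_one (n : ℕ) : 2 * (natRun 1 n).sum = n * (n + 1) := by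
  induction n with
  | zero => rfl
  | succ n ih =>
    rw [natRun_add, natRun_one, Multiset.sum_add, Multiset.sum_singleton, mul_add, ih]
    ring

/-- If all parts of each column above `a` can be grouped, it remains to group the parts `1, …, a`. -/
theorem Splits.of_column {d a n f : ℕ} {X : Multiset ℕ} (hX : natRun 1 n = natRun 1 a + X)
    (h : Splits (d • X) f) (hdvd : f ∣ d * (natRun 1 n).sum)
    (ih : f ∣ d * (natRun 1 a).sum → Splits (d • natRun 1 a) f) : Splits (d • natRun 1 n) f := by
  have h1 := h.dvd_sum
  rw [Multiset.sum_nsmul, smul_eq_mul] at h1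
  rw [hX, Multiset.sum_add, mul_add, ← Nat.dvd_add_iff_left h1] at hdvd
  rw [hX, nsmul_add]
  exact (ih hdvd).add h

/-- `2 * q - 1` copies of `[r, q * e - r]` split into groups of sum `(2 * q - 1) * e`, `e` odd. -/
theorem splits_symm_run {q e r : ℕ} (hq : 2 ≤ q) (hr : r ≤ e) (he : Odd e) :
    Splits ((2 * q - 1) • natRun r (q * e + 1 - 2 * r)) ((2 * q - 1) * e) := by
  obtain ⟨ε, rfl⟩ := he
  rcases Nat.even_or_odd' q with ⟨k, rfl | rfl⟩
  · obtain ⟨K, rfl⟩ : ∃ K, k = K + 1 := ⟨k - 1, by omega⟩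
    have := splits_symm_run_even K (2 * ε + 1) r hr
    rwa [show 2 * (2 * (K + 1)) - 1 = 4 * K + 3 by omega]
  · obtain ⟨K, rfl⟩ : ∃ K, k = K + 1 := ⟨k - 1, by omega⟩
    have hc : (2 * (K + 1) + 1) * (2 * ε + 1) = 2 * (2 * (K * ε) + K + 3 * ε + 1) + 1 := by ring
    have hle : 0 ≤ K * ε := Nat.zero_le _
    have := splits_symm_run_odd K ε r (2 * (K * ε) + K + 3 * ε + 1 - r - ε) hr (by
      rw [show (2 * K + 3) * (2 * ε + 1) = 2 * (2 * (K * ε) + K + 3 * ε + 1) + 1 by ring]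
      omega)
    rwa [show 2 * (2 * (K + 1) + 1) - 1 = 4 * K + 5 by omega, hc,
      show 2 * (2 * (K * ε) + K + 3 * ε + 1) + 1 + 1 - 2 * r =
        2 * (ε + 1 + (2 * (K * ε) + K + 3 * ε + 1 - r - ε)) by omega]

/-- `d` copies of `{1, …, n}` split into groups of sum `f`, for every `f ≥ n` dividing their sum. -/
theorem splits_nsmul_natRun_one (d n f : ℕ) (hnf : n ≤ f) (hf : 0 < f)
    (hdvd : f ∣ d * (natRun 1 n).sum) : Splits (d • natRun 1 n) f := by
  induction hN : d + n + f using Nat.strong_induction_on generalizing d n f with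
  | _ N ih =>
  subst hN
  replace ih : ∀ d' n' f', d' + n' + f' < d + n + f → n' ≤ f' → 0 < f' →
      f' ∣ d' * (natRun 1 n').sum → Splits (d' • natRun 1 n') f' :=
    fun d' n' f' hlt h1 h2 h3 => ih _ hlt d' n' f' h1 h2 h3 rfl
  rcases Nat.eq_zero_or_pos n with rfl | hn
  · simpa [natRun_zero] using Splits.zero f
  rcases Nat.eq_zero_or_pos d with rfl | hd
  · simpa using Splits.zero f
  have hsum := two_mul_sum_natRun_one n
  rcases hnf.eq_or_lt with rfl | hlt
  · obtain ⟨m, rfl⟩ : ∃ m, n = m + 1 := ⟨n - 1, by omega⟩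
    refine Splits.of_column (natRun_add 1 m 1) (Splits.nsmul ?_ d) hdvd
      (ih d m (m + 1) (by omega) (by omega) (by omega))
    exact (SplitsInto.singleton (by rw [natRun_one, Multiset.sum_singleton, add_comm])).splits
  rcases Nat.even_or_odd' f with ⟨t, rfl | hfo⟩
  · rcases le_or_gt t n with htn | htn
    · -- complementary pairs leave the half `t` and the parts below `2 * t - n`
      have hcol : natRun 1 n = natRun 1 (2 * t - n - 1) + {t} +
          (natRun (2 * t - n) (n - t) + natRun (t + 1) (n - t)) := by
        have h1 : natRun 1 n = natRun 1 (2 * t - n - 1) + (natRun (2 * t - n) (n - t) +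
            (natRun t 1 + natRun (t + 1) (n - t))) := by
          rw [natRun_append (by omega), natRun_append (by omega), natRun_append (by omega)]
          congr 1; omega
        rw [h1, natRun_one]; abel
      have hX := (splitsInto_natRun_pairs (2 * t - n) (t + 1) (n - t)).splits.nsmul d
      rw [show 2 * t - n + (t + 1) + (n - t) - 1 = 2 * t by omega] at hX
      have hXd := hX.dvd_sum
      rw [Multiset.sum_nsmul, smul_eq_mul] at hXd
      rw [hcol, Multiset.sum_add, mul_add, ← Nat.dvd_add_iff_left hXd] at hdvd
      rw [hcol, nsmul_add]
      refine Splits.add ?_ hX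
      refine Splits.merge ?_ (by omega) (by rwa [Multiset.sum_nsmul, smul_eq_mul])
      rw [nsmul_add]
      refine Splits.add (ih _ _ _ (by omega) (by omega) (by omega) ?_)
        ((SplitsInto.singleton (Multiset.sum_singleton t)).splits.nsmul d)
      rw [Multiset.sum_add, Multiset.sum_singleton, mul_add] at hdvd
      exact (Nat.dvd_add_iff_left (Dvd.intro_left d rfl)).2 (dvd_of_mul_left_dvd hdvd)
    · have := ih d n t (by omega) (by omega) (by omega) (dvd_of_mul_left_dvd hdvd)
      exact this.merge (by omega) (by rwa [Multiset.sum_nsmul, smul_eq_mul])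
  rcases le_or_gt f (2 * n) with htn | htn
  · subst hfo
    have hcol : natRun 1 n = natRun 1 (2 * t - n) +
        (natRun (2 * t + 1 - n) (n - t) + natRun (t + 1) (n - t)) := by
      rw [natRun_append (by omega), natRun_append (by omega)]
      congr 1; omega
    have hX := (splitsInto_natRun_pairs (2 * t + 1 - n) (t + 1) (n - t)).splits.nsmul d
    rw [show 2 * t + 1 - n + (t + 1) + (n - t) - 1 = 2 * t + 1 by omega] at hX
    exact Splits.of_column hcol hX hdvd (ih _ _ _ (by omega) (by omega) (by omega))
  obtain ⟨g, hg⟩ := hdvd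
  have hSpos : 0 < (natRun 1 n).sum := by nlinarith
  have hgpos : 0 < g := Nat.pos_of_ne_zero fun h0 => by
    have : 0 < d * (natRun 1 n).sum := Nat.mul_pos hd hSpos
    simp [hg, h0] at this
  by_cases hdf : d ∣ f
  swap
  · obtain ⟨d', hd'⟩ := Nat.gcd_dvd_left d g
    obtain ⟨g', hg'⟩ := Nat.gcd_dvd_right d g
    have hp0 : 0 < d.gcd g := Nat.gcd_pos_of_pos_left g hd
    have hp1 : d.gcd g ≠ 1 := fun h1 =>
      hdf (Nat.Coprime.dvd_of_dvd_mul_right h1 ⟨_, hg.symm⟩)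
    have hd'0 : 0 < d' := Nat.pos_of_ne_zero fun h0 => by simp [h0] at hd'; omega
    have hlt' : d' < d := by
      have : 2 ≤ d.gcd g := by omega
      nlinarith
    have := ih d' n f (by omega) hnf hf ⟨g', by
      apply Nat.eq_of_mul_eq_mul_left hp0
      rw [← mul_assoc, ← hd', hg]
      conv_lhs => rw [hg']
      ring⟩
    have h2 := this.nsmul (d.gcd g)
    rwa [← mul_nsmul', ← hd'] at h2
  obtain ⟨e, he⟩ := hdf
  have hepos : 0 < e := Nat.pos_of_ne_zero fun h0 => by simp [h0] at he; omega
  have heo : Odd e := by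
    have : Odd (d * e) := ⟨t, by omega⟩
    exact (Nat.odd_mul.1 this).2
  have hSe : (natRun 1 n).sum = g * e := by
    apply Nat.eq_of_mul_eq_mul_left hd
    rw [hg, he]; ring
  obtain ⟨q, hq⟩ : ∃ q, q = n / e + 1 := ⟨_, rfl⟩
  have hq1 : n < q * e := by rw [hq, mul_comm]; exact Nat.lt_mul_div_succ n hepos
  have hq2 : q * e ≤ n + e := by
    have := Nat.div_mul_le_self n e
    rw [hq, add_mul]; omega
  have hqd : 2 * q ≤ d + 1 := by
    by_contra hcon
    have : d + 2 ≤ 2 * q := by omega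
    have := Nat.mul_le_mul_right e this
    nlinarith
  have hqpos : 0 < q := hq ▸ Nat.succ_pos _
  rcases le_or_gt (2 * q) d with hqd' | hqd'
  · have hmul : (d - q) * e = f - q * e := by rw [Nat.sub_mul, he]
    have hqe : q * e < f := by rw [he]; exact Nat.mul_lt_mul_of_pos_right (by omega) hepos
    have h1 := (ih q n (q * e) (by omega) hq1.le (by omega)
      ⟨g, by rw [hSe]; ring⟩).splitsInto (g := g) (by omega)
      (by rw [Multiset.sum_nsmul, smul_eq_mul, hSe]; ring)
    have hle : q * e ≤ (d - q) * e := Nat.mul_le_mul_right e (by omega)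
    have h2 := (ih (d - q) n ((d - q) * e) (by omega) (by omega) (by omega)
      ⟨g, by rw [hSe]; ring⟩).splitsInto (g := g) (by omega)
      (by rw [Multiset.sum_nsmul, smul_eq_mul, hSe]; ring)
    have h3 := (h1.concat h2).splits
    rwa [← add_nsmul, ← add_mul, show q + (d - q) = d by omega, ← he] at h3
  obtain rfl : d = 2 * q - 1 := by omega
  rcases (Nat.succ_le_of_lt hqpos).eq_or_lt with hq1' | hq1'
  · obtain rfl : q = 1 := by omega
    obtain rfl : f = e := by simpa using he
    rw [hSe] at hsum
    have hgn : 2 * g ≤ n := by nlinarith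
    have hkey : 3 * n + 1 ≤ f + 4 * g := by
      have h1 : 0 ≤ ((f : ℤ) - 2 * n) * (f - n - 1) := by
        apply mul_nonneg <;> omega
      have h2 : (2 : ℤ) * (g * f) = n * (n + 1) := by exact_mod_cast hsum
      have h3 : (f : ℤ) * (3 * n + 1) ≤ f * (f + 4 * g) := by nlinarith
      exact_mod_cast le_of_mul_le_mul_left h3 (by exact_mod_cast hf)
    have hcol : natRun 1 n = natRun 1 (n - 2 * g) +
        (natRun (n - 2 * g + 1) g + natRun (n - g + 1) g) := by
      rw [natRun_append (by omega), natRun_append (by omega)]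
      congr 1; omega
    have hX := splitsInto_natRun_pairs (n - 2 * g + 1) (n - g + 1) g
    have hXs := hX.sum_eq
    have hS : (natRun 1 (n - 2 * g)).sum = g * (f - (2 * n - 2 * g + 1)) := by
      have := congrArg Multiset.sum hcol
      rw [Multiset.sum_add, hSe, hXs] at this
      rw [Nat.mul_sub, show 2 * n - 2 * g + 1 = n - 2 * g + 1 + (n - g + 1) + g - 1 by omega]
      omega
    have h1 := (ih 1 (n - 2 * g) (f - (2 * n - 2 * g + 1)) (by omega) (by omega) (by omega)
      ⟨g, by rw [hS]; ring⟩).splitsInto (g := g) (by omega) (by rw [one_nsmul, hS])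
    have h2 := (h1.concat hX).splits
    rw [show f - (2 * n - 2 * g + 1) + (n - 2 * g + 1 + (n - g + 1) + g - 1) = f by omega,
      one_nsmul, ← hcol] at h2
    simpa using h2
  · have hX := splits_symm_run (r := q * e - n) hq1' (by omega) heo
    rw [← he] at hX
    have h2e : 2 * e ≤ q * e := Nat.mul_le_mul_right e hq1'
    have hcol : natRun 1 n = natRun 1 (q * e - n - 1) +
        natRun (q * e - n) (q * e + 1 - 2 * (q * e - n)) := by
      rw [natRun_append (by omega)]
      congr 1; omega
    exact Splits.of_column hcol hX ⟨g, hg⟩ (ih _ _ _ (by omega) (by omega) (by omega))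

theorem map_div_range (i d : ℕ) :
    (Multiset.range (i * d)).map (fun j => j / d + 1) = d • natRun 1 i := by
  induction i with
  | zero => simp [natRun_zero]
  | succ i ih =>
    rw [add_mul, one_mul, Multiset.range_add, Multiset.map_add, ih, natRun_add, natRun_one,
      nsmul_add, Multiset.map_map, Multiset.nsmul_singleton]
    congr 1
    rw [Multiset.eq_replicate]
    refine ⟨by simp, fun x hx => ?_⟩
    obtain ⟨y, hy, rfl⟩ := Multiset.mem_map.1 hx
    rw [Multiset.mem_range] at hy
    rw [Function.comp_apply, mul_comm, Nat.mul_add_div (by omega), Nat.div_eq_of_lt hy]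
    omega

/-- A splitting of the multiset of weights `w j`, `j ∈ s`, comes from an assignment of indices. -/
theorem exists_assignment {ι κ : Type*} [DecidableEq ι] [Fintype κ] [DecidableEq κ] [Nonempty κ]
    (w : ι → ℕ) (s : Finset ι) (P : κ → Multiset ℕ) (hP : ∑ k, P k = s.val.map w) :
    ∃ a : ι → κ, ∀ k, ∑ j ∈ s with a j = k, w j = (P k).sum := by
  induction s using Finset.induction_on generalizing P with
  | empty =>
    refine ⟨fun _ => Classical.arbitrary κ, fun k => ?_⟩
    have : P k = 0 := by
      simp only [Finset.empty_val, Multiset.map_zero] at hP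
      exact Finset.sum_eq_zero_iff.1 hP k (Finset.mem_univ k)
    simp [this]
  | insert x s hx ih =>
    rw [Finset.insert_val_of_notMem hx, Multiset.map_cons] at hP
    obtain ⟨k, -, hk⟩ := Multiset.mem_sum.1 (hP ▸ Multiset.mem_cons_self (w x) _)
    obtain ⟨Q, hQ⟩ := Multiset.exists_cons_of_mem hk
    obtain ⟨a, ha⟩ := ih (Function.update P k Q) (by
      rw [← Finset.add_sum_erase _ _ (Finset.mem_univ k)] at hP ⊢
      rw [hQ, Multiset.cons_add] at hP
      rw [Function.update_self, ← (Multiset.cons_inj_right _).1 hP]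
      congr 1
      exact Finset.sum_congr rfl fun y hy => by
        rw [Function.update_of_ne (Finset.ne_of_mem_erase hy)])
    refine ⟨Function.update a x k, fun l => ?_⟩
    have hs : ∑ j ∈ s with Function.update a x k j = l, w j = ∑ j ∈ s with a j = l, w j := by
      congr 1
      refine Finset.filter_congr fun j hj => ?_
      rw [Function.update_of_ne (by rintro rfl; exact hx hj)]
    rw [Finset.filter_insert, Function.update_self]
    by_cases hkl : k = l
    · subst hkl
      rw [if_pos rfl, Finset.sum_insert (by simp [hx]), hs, ha, Function.update_self, hQ,
        Multiset.sum_cons]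
    · rw [if_neg hkl, hs, ha, Function.update_of_ne (Ne.symm hkl)]

/-- Consecutive intervals of lengths `w j`, `j ∈ s`, cover `[0, ∑ j ∈ s, w j]`. -/
theorem exists_mem_consecutive {ι : Type*} [LinearOrder ι] (w : ι → ℝ) (s : Finset ι)
    (hs : s.Nonempty) (x : ℝ) (hx0 : 0 ≤ x) (hx : x ≤ ∑ j ∈ s, w j) :
    ∃ j ∈ s, ∑ l ∈ s with l < j, w l ≤ x ∧ x ≤ ∑ l ∈ s with l < j, w l + w j := by
  induction s using Finset.induction_on_max with
  | empty => simp at hs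
  | insert m s hm ih =>
    have hms : m ∉ s := fun h => (hm m h).false
    by_cases hxs : ∑ j ∈ s, w j ≤ x
    · have : (insert m s).filter (· < m) = s := by
        rw [Finset.filter_insert, if_neg (lt_irrefl m), Finset.filter_true_of_mem hm]
      refine ⟨m, Finset.mem_insert_self m s, ?_⟩
      rw [this]
      rw [Finset.sum_insert hms] at hx
      exact ⟨hxs, by linarith⟩
    · push Not at hxs
      obtain ⟨j, hj, h⟩ := ih (by
        rw [Finset.nonempty_iff_ne_empty]
        rintro rfl
        simp only [Finset.sum_empty] at hxs
        linarith) hxs.le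
      refine ⟨j, Finset.mem_insert_of_mem hj, ?_⟩
      rwa [Finset.filter_insert, if_neg (hm j hj).not_gt]

theorem isPlacement_Icc (w h x y : ℝ) :
    IsPlacement w h (Set.Icc x (x + w) ×ˢ Set.Icc y (y + h)) := by
  refine ⟨(x, y), Or.inl ?_⟩
  ext ⟨u, v⟩
  simp only [rectWH, Set.mem_prod, Set.mem_Icc, Set.mem_image, Prod.exists, Prod.mk_add_mk,
    Prod.mk.injEq]
  constructor
  · rintro ⟨⟨h1, h2⟩, h3, h4⟩
    exact ⟨u - x, v - y, ⟨⟨by linarith, by linarith⟩, by linarith, by linarith⟩, by ring, by ring⟩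
  · rintro ⟨a, b, ⟨⟨h1, h2⟩, h3, h4⟩, rfl, rfl⟩
    exact ⟨⟨by linarith, by linarith⟩, by linarith, by linarith⟩

/-- Tiles of common height `L`, assigned to `g` rows of total width `f` each, tile a rectangle. -/
theorem tilesRect_of_rows {n g f : ℕ} (w : Fin n → ℕ) {L : ℝ} (hL : 0 < L) (a : Fin n → Fin g)
    (hg : 0 < g) (hf : 0 < f) (hrow : ∀ k, ∑ j with a j = k, w j = f) :
    TilesRect (fun j => ((w j : ℝ), L)) (f : ℝ) (g * L) := by
  have hrow' : ∀ k, ∑ j with a j = k, (w j : ℝ) = f := fun k => by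
    rw [← hrow k]; push_cast; rfl
  set X : Fin n → ℝ := fun j => ∑ l ∈ {l | a l = a j} with l < j, (w l : ℝ) with hX
  have hX0 : ∀ j, 0 ≤ X j := fun j => Finset.sum_nonneg fun _ _ => Nat.cast_nonneg _
  have hXw : ∀ j, X j + w j = ∑ l ∈ {l | a l = a j} with l ≤ j, (w l : ℝ) := fun j => by
    have : Finset.filter (· ≤ j) {l | a l = a j} =
        insert j (Finset.filter (· < j) {l | a l = a j}) := by
      ext l
      simp only [Finset.mem_filter, Finset.mem_univ, true_and, Finset.mem_insert, le_iff_lt_or_eq]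
      constructor
      · rintro ⟨h1, h2 | h2⟩
        · exact Or.inr ⟨h1, h2⟩
        · exact Or.inl h2
      · rintro (rfl | ⟨h1, h2⟩)
        · exact ⟨rfl, Or.inr rfl⟩
        · exact ⟨h1, Or.inl h2⟩
    rw [this, Finset.sum_insert (by simp), add_comm]
  have hXf : ∀ j, X j + w j ≤ f := fun j => by
    rw [hXw, ← hrow' (a j)]
    exact Finset.sum_le_sum_of_subset_of_nonneg (Finset.filter_subset _ _)
      fun _ _ _ => Nat.cast_nonneg _
  have hXlt : ∀ l j, a l = a j → l < j → X l + w l ≤ X j := fun l j h hlt => by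
    rw [hXw, h]
    refine Finset.sum_le_sum_of_subset_of_nonneg (fun m hm => ?_) fun _ _ _ => Nat.cast_nonneg _
    simp only [Finset.mem_filter] at hm ⊢
    exact ⟨hm.1, hm.2.trans_lt hlt⟩
  refine ⟨fun j => Set.Icc (X j) (X j + w j) ×ˢ Set.Icc ((a j : ℕ) * L) ((a j : ℕ) * L + L),
    fun j => isPlacement_Icc _ _ _ _, ?_, ?_⟩
  · intro l j hlj
    ext ⟨x, y⟩
    simp only [interior_prod_eq, interior_Icc, Set.mem_inter_iff, Set.mem_prod, Set.mem_Ioo,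
      Set.mem_empty_iff_false, iff_false]
    rintro ⟨⟨⟨h1, h2⟩, h3, h4⟩, ⟨h5, h6⟩, h7, h8⟩
    have hrows : ∀ p q : Fin g, (p : ℕ) * L < y → y < (q : ℕ) * L + L → p ≤ q := by
      intro p q hp hq
      by_contra! hqp
      have : ((q : ℕ) : ℝ) + 1 ≤ (p : ℕ) := by exact_mod_cast hqp
      nlinarith
    have hal : a l = a j := le_antisymm (hrows _ _ h3 h8) (hrows _ _ h7 h4)
    rcases hlj.lt_or_gt with h | h
    · have := hXlt l j hal h
      linarith
    · have := hXlt j l hal.symm h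
      linarith
  · ext ⟨x, y⟩
    simp only [Set.mem_iUnion, rectWH, Set.mem_prod, Set.mem_Icc]
    constructor
    · rintro ⟨j, ⟨h1, h2⟩, h3, h4⟩
      have h5 : ((a j : ℕ) : ℝ) + 1 ≤ g := by exact_mod_cast (a j).2
      have h6 : 0 ≤ ((a j : ℕ) : ℝ) * L := by positivity
      exact ⟨⟨(hX0 j).trans h1, h2.trans (hXf j)⟩, h6.trans h3, by nlinarith⟩
    · rintro ⟨⟨h1, h2⟩, h3, h4⟩
      obtain ⟨k, hk1, hk2⟩ : ∃ k : Fin g, (k : ℕ) * L ≤ y ∧ y ≤ (k : ℕ) * L + L := by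
        by_cases hy : ⌊y / L⌋₊ < g
        · refine ⟨⟨_, hy⟩, ?_, ?_⟩
          · exact (le_div_iff₀ hL).1 (Nat.floor_le (by positivity))
          · have := (div_lt_iff₀ hL).1 (Nat.lt_floor_add_one (y / L))
            simp only
            linarith
        · have hgy : (g : ℝ) ≤ y / L := (Nat.le_floor_iff (by positivity)).1 (not_lt.1 hy)
          rw [le_div_iff₀ hL] at hgy
          refine ⟨⟨g - 1, by omega⟩, ?_⟩
          simp only [Nat.cast_pred hg]
          constructor <;> linarith
      obtain ⟨j, hj, h5, h6⟩ := exists_mem_consecutive (fun j => (w j : ℝ))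
        (Finset.univ.filter (a · = k)) (Finset.nonempty_of_sum_ne_zero (f := w) (by
          rw [hrow k]; omega)) x h1 (by rw [hrow' k]; exact h2)
      obtain rfl : a j = k := by simpa using hj
      exact ⟨j, ⟨h5, h6⟩, hk1, hk2⟩

/-- Let `i ≥ 1`, `m = i(i+1)/2`, let `h` be a positive multiple of `m` and `d = h / m`.
For every `L > 0` and every divisor `f` of `h` with `f ≥ i`, the set of `i·d` tiles
consisting of `d` copies each of `k × L` for `k = 1, …, i` tiles an `f × (hL/f)` rectangle. -/
theorem hcn_tiles_layouts (i : ℕ) (hi : 0 < i) (h : ℕ) (hh : 0 < h)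
    (hm : i * (i + 1) / 2 ∣ h) (d : ℕ) (hd : d = h / (i * (i + 1) / 2))
    (L : ℝ) (hL : 0 < L) (f : ℕ) (hf : f ∣ h) (hfi : i ≤ f) :
    TilesRect (dimsGen i d L) (f : ℝ) ((h : ℝ) * L / (f : ℝ)) := by
  obtain ⟨m, rfl⟩ := hf
  have hf0 : 0 < f := Nat.pos_of_mul_pos_right hh
  have hm0 : 0 < m := Nat.pos_of_mul_pos_left hh
  have hsum : (natRun 1 i).sum = i * (i + 1) / 2 := by
    have := two_mul_sum_natRun_one i
    omega
  have hmass : d * (natRun 1 i).sum = m * f := by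
    rw [hd, hsum, Nat.div_mul_cancel hm, mul_comm]
  obtain ⟨P, hP, hPs⟩ := (splits_nsmul_natRun_one d i f hfi hf0
    ⟨m, by rw [hmass, mul_comm]⟩).splitsInto (g := m) hf0
    (by rw [Multiset.sum_nsmul, smul_eq_mul, hmass])
  have : Nonempty (Fin m) := ⟨⟨0, hm0⟩⟩
  obtain ⟨a, ha⟩ := exists_assignment (fun j : Fin (i * d) => (j : ℕ) / d + 1) Finset.univ P (by
    have h : (Finset.univ : Finset (Fin (i * d))).val.map Fin.val = Multiset.range (i * d) := by
      have := congrArg Finset.val (Fin.map_valEmbedding_univ (n := i * d))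
      rwa [Nat.Iio_eq_range] at this
    rw [hP, ← map_div_range, ← h, Multiset.map_map]
    rfl)
  have := tilesRect_of_rows (fun j : Fin (i * d) => (j : ℕ) / d + 1) hL a hm0 hf0
    fun k => by rw [ha, hPs]
  have hH : ((f * m : ℕ) : ℝ) * L / f = m * L := by
    have : (f : ℝ) ≠ 0 := by positivity
    push_cast
    field_simp
  rw [hH]
  exact this
end

section
/- For every prime number p there exists a highly composite number that is divisible by p; that is, there exists a positive integer n with p ∣ n such that every positive integer m < n has strictly fewer divisors than n. -/
/-- A number all of whose smaller positive integers have strictly fewer divisors. -/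
def IsHighlyComposite (n : ℕ) : Prop :=
  ∀ m : ℕ, 0 < m → m < n → (Nat.divisors m).card < (Nat.divisors n).card

theorem card_divisors_prime_pow_mul {q m : ℕ} (hq : q.Prime) (hqm : ¬ q ∣ m) (a : ℕ) :
    (Nat.divisors (q ^ a * m)).card = (a + 1) * (Nat.divisors m).card := by
  have hc : Nat.Coprime (q ^ a) m := ((Nat.Prime.coprime_iff_not_dvd hq).2 hqm).pow_left a
  rw [hc.card_divisors_mul, Nat.divisors_prime_pow hq, Finset.card_map, Finset.card_range]

/-- Prime divisors of a highly composite number lie below any prime not dividing it. -/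
theorem IsHighlyComposite.prime_lt_of_dvd {n p q : ℕ} (hn : IsHighlyComposite n) (hn0 : n ≠ 0)
    (hp : p.Prime) (hpn : ¬ p ∣ n) (hq : q.Prime) (hqn : q ∣ n) : q < p := by
  by_contra! hpq
  have hlt : p < q := lt_of_le_of_ne hpq (by rintro rfl; exact hpn hqn)
  obtain ⟨a, m, hqm, rfl⟩ := Nat.exists_eq_pow_mul_and_not_dvd hn0 q hq.ne_one
  have hpm : ¬ p ∣ m := fun h => hpn (h.mul_left _)
  have ha : a ≠ 0 := by rintro rfl; simp [hqm] at hqn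
  have hm : 0 < m := Nat.pos_of_ne_zero (right_ne_zero_of_mul hn0)
  have h := hn (p ^ a * m) (Nat.mul_pos (pow_pos hp.pos a) hm)
    (Nat.mul_lt_mul_of_pos_right (Nat.pow_lt_pow_left hlt ha) hm)
  rw [card_divisors_prime_pow_mul hq hqm, card_divisors_prime_pow_mul hp hpm] at h
  exact h.false

/-- If a prime `p` does not divide a highly composite number, then the exponents in its
factorization are bounded in terms of `p`. -/
theorem IsHighlyComposite.factorization_lt {n p q : ℕ} (hn : IsHighlyComposite n) (hn0 : n ≠ 0)
    (hp : p.Prime) (hpn : ¬ p ∣ n) (hq : q.Prime) : n.factorization q < 2 * p := by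
  obtain ⟨a, m, hqm, rfl⟩ := Nat.exists_eq_pow_mul_and_not_dvd hn0 q hq.ne_one
  have hm : 0 < m := Nat.pos_of_ne_zero (right_ne_zero_of_mul hn0)
  have hfac : (q ^ a * m).factorization q = a := by
    rw [Nat.factorization_mul (pow_pos hq.pos a).ne' hm.ne', Finsupp.add_apply,
      hq.factorization_pow, Finsupp.single_eq_same, Nat.factorization_eq_zero_of_not_dvd hqm,
      add_zero]
  rw [hfac]
  by_contra! ha
  obtain ⟨b, rfl⟩ := Nat.exists_eq_add_of_le (show p ≤ a by omega)
  have hpb : ¬ p ∣ q ^ b * m := fun h => hpn (by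
    rw [pow_add, mul_assoc]; exact h.mul_left _)
  have hpos : 0 < q ^ b * m := Nat.mul_pos (pow_pos hq.pos b) hm
  have h := hn (p ^ 1 * (q ^ b * m)) (Nat.mul_pos (pow_pos hp.pos 1) hpos) (by
    rw [pow_one, pow_add, mul_assoc]
    exact Nat.mul_lt_mul_of_pos_right (Nat.lt_pow_self hq.one_lt) hpos)
  rw [card_divisors_prime_pow_mul hp hpb, card_divisors_prime_pow_mul hq hqm,
    card_divisors_prime_pow_mul hq hqm, ← mul_assoc] at h
  have := Nat.lt_of_mul_lt_mul_right h
  omega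

theorem IsHighlyComposite.card_divisors_le {n p : ℕ} (hn : IsHighlyComposite n) (hn0 : n ≠ 0)
    (hp : p.Prime) (hpn : ¬ p ∣ n) : (Nat.divisors n).card ≤ (2 * p) ^ p := by
  rw [Nat.card_divisors hn0]
  have hsub : n.primeFactors ⊆ Finset.range p := fun q hq =>
    Finset.mem_range.2 (hn.prime_lt_of_dvd hn0 hp hpn (Nat.prime_of_mem_primeFactors hq)
      (Nat.dvd_of_mem_primeFactors hq))
  calc ∏ q ∈ n.primeFactors, (n.factorization q + 1)
      ≤ (2 * p) ^ n.primeFactors.card := Finset.prod_le_pow_card _ _ _ fun q hq =>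
        hn.factorization_lt hn0 hp hpn (Nat.prime_of_mem_primeFactors hq)
    _ ≤ (2 * p) ^ p := Nat.pow_le_pow_right (by have := hp.pos; omega)
        (by simpa using Finset.card_le_card hsub)

/-- There are highly composite numbers with arbitrarily many divisors. -/
theorem exists_isHighlyComposite_lt_card_divisors (K : ℕ) :
    ∃ n : ℕ, IsHighlyComposite n ∧ K < (Nat.divisors n).card := by
  classical
  have hex : ∃ n : ℕ, K < (Nat.divisors n).card :=
    ⟨2 ^ K, by simp [Nat.divisors_prime_pow Nat.prime_two]⟩
  exact ⟨Nat.find hex, fun m _ hm =>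
    (not_lt.1 (Nat.find_min hex hm)).trans_lt (Nat.find_spec hex), Nat.find_spec hex⟩

/-- For every prime `p` there is a highly composite number divisible by `p`: a positive
integer `n` with `p ∣ n` such that every positive integer `m < n` has strictly fewer divisors
than `n`. -/
theorem exists_highly_composite_multiple_of_prime (p : ℕ) (hp : p.Prime) :
    ∃ n : ℕ, 0 < n ∧ p ∣ n ∧
      ∀ m : ℕ, 0 < m → m < n → (Nat.divisors m).card < (Nat.divisors n).card := by
  obtain ⟨n, hn, hK⟩ := exists_isHighlyComposite_lt_card_divisors ((2 * p) ^ p)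
  have hn0 : n ≠ 0 := by rintro rfl; simp at hK
  refine ⟨n, Nat.pos_of_ne_zero hn0, ?_, hn⟩
  by_contra hpn
  exact (hn.card_divisors_le hn0 hp hpn).not_gt hK
end
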